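/- There exists a weighted SCSP P such that some Pareto efficient joint strategy of the associated local game L(P) is not an optimal solution of P; hence the inclusion of the set of optimal solutions in the set of Pareto efficient joint strategies of L(P) for SCSPs with strictly monotonic combination can be strict. (For instance, the weighted SCSP with two variables x, y, each with domain {a,b}, unary constraints C_x := {(a,2),(b,1)} and C_y := {(a,4),(b,7)}, and binary constraint C_{xy} := {(aa,0),(ab,10),(ba,10),(bb,0)}, in which bb is a Pareto efficient joint strategy of L(P) but only aa is an optimal solution of P.) -/

import Mathlib

/-- An (abstract) soft constraint satisfaction problem (SCSP) over a linearly
ordered commutative monoid `M` (written multiplicatively), with variable set `V`.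
Each constraint `c` has a scope `con c ⊆ V` and a valuation `val c`, canonically
extended to full assignments, which only depends on the variables in the scope. -/
structure SCSP (V : Type) (M : Type) [LinearOrder M] [CommMonoid M] where
  /-- the (nonempty) domain of each variable -/
  D : V → Type
  Dne : ∀ v, Nonempty (D v)
  /-- index type for the (finitely many) constraints -/
  ι : Type
  fin : Fintype ι
  /-- the scope of each constraint -/
  con : ι → Finset V
  /-- the valuation of each constraint, canonically extended to full assignments -/
  val : ι → ((v : V) → D v) → M
  /-- the valuation only depends on the variables in the scope -/
  val_scope : ∀ c s s', (∀ v ∈ con c, s v = s' v) → val c s = val c s'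

namespace SCSP

variable {V M : Type} [LinearOrder M] [CommMonoid M] (P : SCSP V M)

/-- The preference of a full assignment: the combination of the valuations of
all constraints. -/
def pref (s : (v : V) → P.D v) : M :=
  letI := P.fin
  ∏ c : P.ι, P.val c s

/-- The payoff of player `v` in the local game `L(P)`: the combination of the
valuations of the constraints whose scope contains `v`. -/
noncomputable def payoff (v : V) (s : (w : V) → P.D w) : M :=
  letI := P.fin
  letI := Classical.decPred (fun c : P.ι => v ∈ P.con c)
  ∏ c ∈ Finset.univ.filter (fun c => v ∈ P.con c), P.val c s

/-- A full assignment is optimal if no full assignment has a strictly higher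
preference. -/
def Optimal (s : (v : V) → P.D v) : Prop :=
  ¬ ∃ s' : (v : V) → P.D v, P.pref s < P.pref s'

/-- A full assignment is a Nash equilibrium of the local game `L(P)` if no
player `v` can strictly increase its payoff by unilaterally changing its value. -/
def NashLocal [DecidableEq V] (s : (v : V) → P.D v) : Prop :=
  ∀ (v : V) (d : P.D v), P.payoff v (Function.update s v d) ≤ P.payoff v s


/-- A full assignment is a Pareto efficient joint strategy of the local game
`L(P)` if no full assignment weakly improves the payoff of every player and
strictly improves the payoff of some player. -/
def ParetoLocal (s : (v : V) → P.D v) : Prop :=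
  ¬ ∃ s' : (v : V) → P.D v,
      (∀ v : V, P.payoff v s ≤ P.payoff v s') ∧ (∃ v : V, P.payoff v s < P.payoff v s')


end SCSP

/-- The carrier of the weighted c-semiring: nonnegative reals with combination
given by addition and with the order reversed (so that costs are minimized).
`Multiplicative` turns the additive monoid into a multiplicative one, and
`OrderDual` reverses the order. -/
abbrev Weighted : Type := Multiplicative (OrderDual NNReal)


/-- The weight of a nonnegative real cost. -/
def Weighted.ofCost (r : NNReal) : Weighted :=
  Multiplicative.ofAdd (OrderDual.toDual r)

theorem Weighted.ofCost_mul (r t : NNReal) : ofCost r * ofCost t = ofCost (r + t) := rfl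

theorem Weighted.ofCost_le {r t : NNReal} : ofCost r ≤ ofCost t ↔ t ≤ r := Iff.rfl

theorem Weighted.ofCost_lt {r t : NNReal} : ofCost r < ofCost t ↔ t < r := Iff.rfl

/-- The costs of a unary constraint on each of two Boolean variables: `2, 1` on the variable
`false` and `4, 7` on the variable `true`. -/
def unaryCost (v d : Bool) : NNReal :=
  bif v then bif d then 7 else 4 else bif d then 1 else 2

/-- The cost of a binary constraint that penalizes different values. -/
def binaryCost (d e : Bool) : NNReal :=
  bif d == e then 0 else 10

/-- A weighted SCSP with two Boolean variables; the constraint `some v` is the unary constraint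
on `v`, and `none` is the binary constraint. -/
def coordinationSCSP : SCSP Bool Weighted where
  D _ := Bool
  Dne _ := ⟨false⟩
  ι := Option Bool
  fin := inferInstance
  con c := c.elim Finset.univ fun v => {v}
  val c s := .ofCost (c.elim (binaryCost (s false) (s true)) fun v => unaryCost v (s v))
  val_scope := by
    rintro (_ | v) s s' h
    · have hx : s false = s' false := h false (Finset.mem_univ _)
      have hy : s true = s' true := h true (Finset.mem_univ _)
      simp [hx, hy]
    · have hv : s v = s' v := h v (Finset.mem_singleton_self v)
      simp [hv]

theorem coordinationSCSP_pref (s : Bool → Bool) :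
    coordinationSCSP.pref s = .ofCost (binaryCost (s false) (s true) +
      (unaryCost true (s true) + unaryCost false (s false))) := by
  change ∏ c : Option Bool, coordinationSCSP.val c s = _
  rw [Fintype.prod_option, Fintype.prod_bool]
  rfl

theorem coordinationSCSP_payoff (v : Bool) (s : Bool → Bool) :
    coordinationSCSP.payoff v s =
      .ofCost (binaryCost (s false) (s true) + unaryCost v (s v)) := by
  classical
  have h : ({c : Option Bool | v ∈ c.elim Finset.univ fun w => ({w} : Finset Bool)} :
      Finset (Option Bool)) = {none, some v} := by
    ext (_ | w) <;> rw [Finset.mem_filter] <;> simp [eq_comm]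
  calc coordinationSCSP.payoff v s
      = ∏ c : Option Bool with v ∈ c.elim Finset.univ fun w => ({w} : Finset Bool),
          coordinationSCSP.val c s :=
        Finset.prod_congr (Finset.filter_congr_decidable ..) fun _ _ => rfl
    _ = _ := by
        rw [h, Finset.prod_pair (Option.some_ne_none v).symm]
        rfl

theorem coordinationSCSP_paretoLocal : coordinationSCSP.ParetoLocal fun _ => true := by
  rintro ⟨s, h, v, hv⟩
  change Bool → Bool at s
  have hx := h false
  have hy := h true
  rw [coordinationSCSP_payoff, coordinationSCSP_payoff, Weighted.ofCost_le] at hx hy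
  rw [coordinationSCSP_payoff, coordinationSCSP_payoff, Weighted.ofCost_lt] at hv
  cases hs : s false <;> cases ht : s true <;> cases v <;>
    simp only [hs, ht, binaryCost, unaryCost] at hx hy hv <;>
    revert hx hy hv <;> norm_num

theorem coordinationSCSP_not_optimal : ¬ coordinationSCSP.Optimal fun _ => true := by
  refine not_not.2 ⟨fun _ => false, ?_⟩
  rw [coordinationSCSP_pref, coordinationSCSP_pref, Weighted.ofCost_lt]
  norm_num [binaryCost, unaryCost]

/-- There exists a weighted SCSP `P` such that some Pareto efficient joint
strategy of the associated local game `L(P)` is not an optimal solution of `P`;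
hence the inclusion of the set of optimal solutions in the set of Pareto
efficient joint strategies of `L(P)` for SCSPs with strictly monotonic
combination can be strict. -/
theorem exists_weighted_paretoLocal_not_optimal :
    ∃ (V : Type) (_ : DecidableEq V) (P : SCSP V Weighted) (s : (v : V) → P.D v),
      P.ParetoLocal s ∧ ¬ P.Optimal s :=
  ⟨Bool, inferInstance, coordinationSCSP, fun _ => true,
    coordinationSCSP_paretoLocal, coordinationSCSP_not_optimal⟩
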